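/- There exists a function F ∈ C^∞(𝕋^ω) (continuous with continuous partial derivatives of all orders, depending on infinitely many variables) whose Fourier series diverges absolutely, i.e., Σ_{p̄ ∈ ℤ^∞} |F̂(p̄)| = ∞. Concretely, F(x) = Σ_{m,n=1}^∞ a_{mn} e^{2πi(x_m + x_n)} where (a_{mn}) are the coefficients of a symmetric quadratic form completely bounded on the unit polydisc with Σ_{m,n} |a_{mn}| = ∞ (e.g., Toeplitz's form); its Fourier coefficients are F̂(ē_m + ē_n) = 2 a_{mn} for m ≠ n, F̂(2ē_m) = a_{mm}, and F̂(p̄) = 0 otherwise. -/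

import Mathlib

open Filter Topology MeasureTheory

/-- The infinite-dimensional torus `𝕋^ω`, the countable product of circles `ℝ/ℤ`,
with the product topology. -/
abbrev InfTorus := ℕ → AddCircle (1 : ℝ)

/-- `f` has the continuous partial derivative `g` with respect to the `p`-th coordinate:
at every point, the derivative of `f` along the `p`-th coordinate exists and is given
by `g` there. -/
def HasCoordPartial (f : InfTorus → ℂ) (p : ℕ) (g : InfTorus → ℂ) : Prop :=
  ∀ (x : InfTorus) (t : ℝ),
    HasDerivAt (fun s : ℝ => f (Function.update x p ((s : ℝ) : AddCircle (1 : ℝ))))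
      (g (Function.update x p ((t : ℝ) : AddCircle (1 : ℝ)))) t

/-- `f ∈ C^∞(𝕋^ω)`: there is a family `D`, indexed by finite lists of coordinates
(multi-indices), of iterated partial derivatives of `f`, all of which are continuous on
`𝕋^ω` with the product topology. -/
def SmoothInfTorus (f : InfTorus → ℂ) : Prop :=
  ∃ D : List ℕ → InfTorus → ℂ,
    D [] = f ∧ (∀ l, Continuous (D l)) ∧ ∀ l p, HasCoordPartial (D l) p (D (p :: l))

/-- The Fourier coefficient of `F : 𝕋^ω → ℂ` (with respect to a measure `ν` on `𝕋^ω`) at a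
character `p̄ ∈ ℤ^∞`, the group of finitely supported integer sequences, represented as
`p : ℕ →₀ ℤ`:  `F̂(p̄) = ∫ F(x) e^{-2πi p̄·x} dν(x)`. -/
noncomputable def fourierCoefInf (ν : Measure InfTorus) (F : InfTorus → ℂ)
    (p : ℕ →₀ ℤ) : ℂ :=
  ∫ x, F x * ((AddCircle.toCircle (-(∑ j ∈ p.support, p j • x j)) : Circle) : ℂ) ∂ν

open Finset in
/-- Parseval's identity for the discrete Fourier transform, on a set of integers that are distinct
modulo `N`. -/
lemma sum_norm_sq_stdAddChar (N : ℕ) [NeZero N] (s : Finset ℕ)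
    (hs : Set.InjOn (fun m : ℕ => (m : ZMod N)) s) (z : ℕ → ℂ) :
    ∑ x : ZMod N, ‖∑ n ∈ s, ZMod.stdAddChar (x * (n : ZMod N)) * z n‖ ^ 2 =
      N * ∑ n ∈ s, ‖z n‖ ^ 2 := by
  have key : ∑ x : ZMod N, ((‖∑ n ∈ s, ZMod.stdAddChar (x * (n : ZMod N)) * z n‖ : ℂ)) ^ 2
      = N * ∑ n ∈ s, (‖z n‖ : ℂ) ^ 2 := by
    calc
      _ = ∑ x : ZMod N, ∑ n ∈ s, ∑ n' ∈ s,
          ZMod.stdAddChar (x * ((n : ZMod N) - (n' : ZMod N))) * (z n * starRingEnd ℂ (z n')) := by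
        refine sum_congr rfl fun x _ => ?_
        rw [← Complex.mul_conj', map_sum, sum_mul_sum]
        refine sum_congr rfl fun n _ => sum_congr rfl fun n' _ => ?_
        rw [RingHom.map_mul, ← AddChar.map_neg_eq_conj, mul_sub, sub_eq_add_neg,
          AddChar.map_add_eq_mul]
        ring
      _ = ∑ n ∈ s, ∑ n' ∈ s,
          (∑ x : ZMod N, ZMod.stdAddChar (x * ((n : ZMod N) - (n' : ZMod N)))) *
            (z n * starRingEnd ℂ (z n')) := by
        rw [sum_comm]
        refine sum_congr rfl fun n _ => ?_
        rw [sum_comm]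
        simp_rw [sum_mul]
      _ = ∑ n ∈ s, ∑ n' ∈ s, if n = n' then N * (z n * starRingEnd ℂ (z n')) else 0 := by
        refine sum_congr rfl fun n hn => sum_congr rfl fun n' hn' => ?_
        rw [AddChar.sum_mulShift _ (ZMod.isPrimitive_stdAddChar N)]
        have : (n : ZMod N) = n' ↔ n = n' := ⟨fun h => hs hn hn' h, fun h => by rw [h]⟩
        simp only [sub_eq_zero, this, ZMod.card]
        split_ifs <;> simp
      _ = _ := by
        rw [mul_sum]
        refine sum_congr rfl fun n hn => ?_
        rw [sum_ite_eq, if_pos hn, Complex.mul_conj']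
  exact_mod_cast key

open Finset in
/-- The quadratic form of the `N × N` discrete Fourier matrix is at most `N ^ (3 / 2)` on the unit
polydisc. -/
lemma norm_sq_stdAddChar_form_le (N : ℕ) [NeZero N] (s : Finset ℕ)
    (hs : Set.InjOn (fun m : ℕ => (m : ZMod N)) s) (hc : #s = N) (z : ℕ → ℂ)
    (hz : ∀ i, ‖z i‖ ≤ 1) :
    ‖∑ m ∈ s, ∑ n ∈ s, ZMod.stdAddChar ((m : ZMod N) * (n : ZMod N)) * z m * z n‖ ^ 2 ≤
      (N : ℝ) ^ 3 := by
  set g : ZMod N → ℂ := fun x => ∑ n ∈ s, ZMod.stdAddChar (x * (n : ZMod N)) * z n with hg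
  have h1 : ‖∑ m ∈ s, ∑ n ∈ s, ZMod.stdAddChar ((m : ZMod N) * (n : ZMod N)) * z m * z n‖
      ≤ ∑ m ∈ s, ‖g m‖ := by
    refine norm_sum_le_of_le _ fun m _ => ?_
    have : ∑ n ∈ s, ZMod.stdAddChar ((m : ZMod N) * (n : ZMod N)) * z m * z n = z m * g m := by
      rw [hg, mul_sum]
      exact sum_congr rfl fun n _ => by ring
    rw [this, norm_mul]
    exact mul_le_of_le_one_left (norm_nonneg _) (hz m)
  have h2 : ∑ m ∈ s, ‖g m‖ ^ 2 ≤ ∑ x, ‖g x‖ ^ 2 := by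
    rw [← sum_image (f := fun x => ‖g x‖ ^ 2) hs]
    exact sum_le_univ_sum_of_nonneg fun x => by positivity
  have h3 : ∑ n ∈ s, ‖z n‖ ^ 2 ≤ N := by
    calc _ ≤ ∑ n ∈ s, (1 : ℝ) := sum_le_sum fun n _ => pow_le_one₀ (norm_nonneg _) (hz n)
      _ = N := by simp [hc]
  rw [sum_norm_sq_stdAddChar N s hs z] at h2
  calc _ ≤ (∑ m ∈ s, ‖g m‖) ^ 2 := by gcongr
    _ ≤ #s * ∑ m ∈ s, ‖g m‖ ^ 2 := sq_sum_le_card_mul_sum_sq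
    _ ≤ N * (N * N) := by rw [hc]; gcongr; exact h2.trans (by gcongr)
    _ = (N : ℝ) ^ 3 := by ring

/-- The index of the dyadic block containing `m`. -/
def blockIndex (m : ℕ) : ℕ := Nat.log 2 (m + 1)

/-- The `k`-th dyadic block of indices. -/
def dyadicBlock (k : ℕ) : Finset ℕ := Finset.Ico (2 ^ k - 1) (2 ^ (k + 1) - 1)

lemma mem_dyadicBlock {k m : ℕ} : m ∈ dyadicBlock k ↔ blockIndex m = k := by
  rw [blockIndex, Nat.log_eq_iff (by simp), dyadicBlock, Finset.mem_Ico]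
  have := Nat.one_le_two_pow (n := k)
  have := Nat.one_le_two_pow (n := k + 1)
  omega

lemma card_dyadicBlock (k : ℕ) : (dyadicBlock k).card = 2 ^ k := by
  rw [dyadicBlock, Nat.card_Ico, pow_succ]
  have := Nat.one_le_two_pow (n := k)
  omega

lemma injOn_cast_dyadicBlock (k : ℕ) :
    Set.InjOn (fun m : ℕ => (m : ZMod (2 ^ k))) (dyadicBlock k) := by
  intro m hm n hn h
  have h' : m ≡ n [MOD 2 ^ k] := (ZMod.natCast_eq_natCast_iff _ _ _).1 h
  simp only [dyadicBlock, Finset.coe_Ico, Set.mem_Ico, pow_succ] at hm hn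
  refine h'.eq_of_abs_lt ?_
  rw [abs_lt]
  have := Nat.one_le_two_pow (n := k)
  have hc : ((2 ^ k : ℕ) : ℤ) = (2 : ℤ) ^ k := by push_cast; rfl
  constructor <;> omega

/-- The coefficients of a block diagonal quadratic form whose `k`-th block is a multiple of the
discrete Fourier matrix of size `2 ^ k`. -/
noncomputable def dftCoef (m n : ℕ) : ℂ :=
  if blockIndex m = blockIndex n then
    ((4 : ℂ) ^ blockIndex m)⁻¹ *
      ZMod.stdAddChar ((m : ZMod (2 ^ blockIndex m)) * (n : ZMod (2 ^ blockIndex m)))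
  else 0

lemma dftCoef_comm (m n : ℕ) : dftCoef m n = dftCoef n m := by
  unfold dftCoef
  have key : ∀ k l : ℕ, k = l →
      ((4 : ℂ) ^ k)⁻¹ * ZMod.stdAddChar ((m : ZMod (2 ^ k)) * (n : ZMod (2 ^ k))) =
        ((4 : ℂ) ^ l)⁻¹ * ZMod.stdAddChar ((n : ZMod (2 ^ l)) * (m : ZMod (2 ^ l))) := by
    rintro k _ rfl
    rw [mul_comm (m : ZMod (2 ^ k))]
  by_cases h : blockIndex m = blockIndex n
  · rw [if_pos h, if_pos h.symm, key _ _ h]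
  · rw [if_neg h, if_neg (Ne.symm h)]

lemma norm_dftCoef {m n : ℕ} (h : blockIndex m = blockIndex n) :
    ‖dftCoef m n‖ = ((4 : ℝ) ^ blockIndex m)⁻¹ := by
  simp [dftCoef, h, AddChar.norm_apply]

lemma not_summable_norm_dftCoef : ¬ Summable fun mn : ℕ × ℕ => ‖dftCoef mn.1 mn.2‖ := by
  intro h
  have hrow (m : ℕ) : Summable fun n => ‖dftCoef m n‖ := h.prod_factor m
  refine (summable_nat_add_iff 1).not.2 Real.not_summable_one_div_natCast ?_
  refine Summable.of_nonneg_of_le (fun m => by positivity) (fun m => ?_) h.prod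
  calc 1 / ((m + 1 : ℕ) : ℝ) ≤ 1 / ((2 ^ blockIndex m : ℕ) : ℝ) := by
        gcongr
        exact Nat.pow_log_le_self 2 (Nat.succ_ne_zero m)
    _ = ∑ n ∈ dyadicBlock (blockIndex m), ‖dftCoef m n‖ := by
        rw [Finset.sum_congr rfl fun n hn => norm_dftCoef (mem_dyadicBlock.1 hn).symm]
        rw [Finset.sum_const, card_dyadicBlock, nsmul_eq_mul,
          show (4 : ℝ) = 2 * 2 by norm_num, mul_pow]
        push_cast
        field_simp
    _ ≤ ∑' n, ‖dftCoef m n‖ := (hrow m).sum_le_tsum _ fun _ _ => norm_nonneg _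

/-- The `k`-th diagonal block of the quadratic form, with its coefficients weighted by `c`. -/
noncomputable def blockForm (c : ℕ → ℕ → ℂ) (k : ℕ) (z : ℕ → ℂ) : ℂ :=
  ∑ m ∈ dyadicBlock k, ∑ n ∈ dyadicBlock k, c m n * dftCoef m n * z m * z n

lemma norm_blockForm_le (k : ℕ) {z : ℕ → ℂ} (hz : ∀ i, ‖z i‖ ≤ 1) :
    ‖blockForm 1 k z‖ ≤ √(1 / 2) ^ k := by
  have h := norm_sq_stdAddChar_form_le (2 ^ k) (dyadicBlock k) (injOn_cast_dyadicBlock k)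
    (card_dyadicBlock k) z hz
  have h' : blockForm 1 k z = ((4 : ℂ) ^ k)⁻¹ * ∑ m ∈ dyadicBlock k, ∑ n ∈ dyadicBlock k,
      ZMod.stdAddChar ((m : ZMod (2 ^ k)) * (n : ZMod (2 ^ k))) * z m * z n := by
    simp_rw [blockForm, Finset.mul_sum]
    refine Finset.sum_congr rfl fun m hm => Finset.sum_congr rfl fun n hn => ?_
    rw [mem_dyadicBlock] at hm hn
    subst hm
    simp only [dftCoef, hn, if_true, Pi.one_apply]
    ring
  refine (sq_le_sq₀ (norm_nonneg _) (by positivity)).1 ?_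
  rw [h', norm_mul, mul_pow, ← pow_mul, mul_comm k, pow_mul, Real.sq_sqrt (by norm_num)]
  calc _ ≤ ‖((4 : ℂ) ^ k)⁻¹‖ ^ 2 * ((2 ^ k : ℕ) : ℝ) ^ 3 := by gcongr
    _ = (1 / 2) ^ k := by
      simp only [norm_inv, norm_pow, Complex.norm_ofNat, Nat.cast_pow, Nat.cast_ofNat]
      rw [one_div_pow, show (4 : ℝ) = 2 * 2 by norm_num, mul_pow]
      field_simp

lemma summable_sqrt_half_pow : Summable fun k : ℕ => √(1 / 2 : ℝ) ^ k :=
  summable_geometric_of_lt_one (Real.sqrt_nonneg _) (by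
    rw [Real.sqrt_lt' one_pos]; norm_num)

/-- The square partial sums of the quadratic form are sums of blocks evaluated at a truncation. -/
lemma sum_range_dftCoef (M : ℕ) (z : ℕ → ℂ) :
    ∑ m ∈ Finset.range M, ∑ n ∈ Finset.range M, dftCoef m n * z m * z n =
      ∑' k, blockForm 1 k fun i => if i < M then z i else 0 := by
  have hB (k : ℕ) : (blockForm 1 k fun i => if i < M then z i else 0) =
      ∑ m ∈ Finset.range M, ∑ n ∈ Finset.range M,
        if k = blockIndex m then dftCoef m n * z m * z n else 0 := by
    have hI : dyadicBlock k ⊆ Finset.range (2 ^ (k + 1) + M) := fun m hm => by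
      simp only [dyadicBlock, Finset.mem_Ico] at hm
      rw [Finset.mem_range]
      omega
    have hM : Finset.range M ⊆ Finset.range (2 ^ (k + 1) + M) :=
      Finset.range_mono (Nat.le_add_left _ _)
    trans ∑ m ∈ Finset.range (2 ^ (k + 1) + M), ∑ n ∈ Finset.range (2 ^ (k + 1) + M),
      if k = blockIndex m then
        dftCoef m n * (if m < M then z m else 0) * (if n < M then z n else 0) else 0
    · rw [blockForm]
      refine Finset.sum_subset_zero_on_sdiff hI (fun m hm => ?_) fun m hm =>
        Finset.sum_subset_zero_on_sdiff hI (fun n hn => ?_) fun n hn => ?_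
      · rw [Finset.mem_sdiff, mem_dyadicBlock] at hm
        exact Finset.sum_eq_zero fun n _ => if_neg (Ne.symm hm.2)
      · rw [Finset.mem_sdiff, mem_dyadicBlock] at hn
        rw [mem_dyadicBlock] at hm
        have h0 : dftCoef m n = 0 := if_neg fun h => hn.2 (h.symm.trans hm)
        simp [h0]
      · rw [mem_dyadicBlock] at hm
        simp [hm]
    · refine (Finset.sum_subset_zero_on_sdiff hM (fun m hm => ?_) fun m hm =>
        Finset.sum_subset_zero_on_sdiff hM (fun n hn => ?_) fun n hn => ?_).symm
      · rw [Finset.mem_sdiff, Finset.mem_range (n := M)] at hm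
        simp [hm.2]
      · rw [Finset.mem_sdiff, Finset.mem_range (n := M)] at hn
        simp [hn.2]
      · rw [Finset.mem_range] at hm hn
        simp [hm, hn]
  have hlt {m : ℕ} (hm : m < M) : blockIndex m < M :=
    ((Nat.log_lt_self 2 (Nat.succ_ne_zero m)).trans_le hm)
  rw [tsum_eq_sum (s := Finset.range M)]
  · simp_rw [hB]
    symm
    rw [Finset.sum_comm]
    refine Finset.sum_congr rfl fun m hm => ?_
    rw [Finset.sum_comm (s := Finset.range M)]
    refine Finset.sum_congr rfl fun n _ => ?_
    rw [Finset.sum_ite_eq', if_pos]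
    exact Finset.mem_range.2 (hlt (Finset.mem_range.1 hm))
  · intro k hk
    rw [hB]
    refine Finset.sum_eq_zero fun m hm => Finset.sum_eq_zero fun n _ => if_neg ?_
    rintro rfl
    exact hk (Finset.mem_range.2 (hlt (Finset.mem_range.1 hm)))

/-- The coordinates of a point of the infinite torus, as complex numbers of modulus one. -/
noncomputable def torusCoord (x : InfTorus) (m : ℕ) : ℂ := ((x m).toCircle : ℂ)

lemma norm_torusCoord (x : InfTorus) (m : ℕ) : ‖torusCoord x m‖ = 1 := Circle.norm_coe _

lemma continuous_torusCoord (m : ℕ) : Continuous fun x => torusCoord x m :=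
  continuous_subtype_val.comp (AddCircle.continuous_toCircle.comp (continuous_apply m))

lemma continuous_blockForm_torusCoord (c : ℕ → ℕ → ℂ) (k : ℕ) :
    Continuous fun x => blockForm c k (torusCoord x) := by
  have := continuous_torusCoord
  unfold blockForm
  fun_prop

/-- The smooth function with absolutely divergent Fourier series. -/
noncomputable def dftSeries (x : InfTorus) : ℂ := ∑' k, blockForm 1 k (torusCoord x)

lemma summable_blockForm (x : InfTorus) : Summable fun k => blockForm 1 k (torusCoord x) :=
  .of_norm_bounded summable_sqrt_half_pow fun k =>
    norm_blockForm_le k fun i => (norm_torusCoord x i).le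

lemma continuous_dftSeries : Continuous dftSeries :=
  continuous_tsum (fun k => continuous_blockForm_torusCoord 1 k) summable_sqrt_half_pow
    fun k x => norm_blockForm_le k fun i => (norm_torusCoord x i).le

lemma norm_sum_range_dftCoef_le (M : ℕ) {z : ℕ → ℂ} (hz : ∀ i, ‖z i‖ ≤ 1) :
    ‖∑ m ∈ Finset.range M, ∑ n ∈ Finset.range M, dftCoef m n * z m * z n‖ ≤
      ∑' k : ℕ, √(1 / 2 : ℝ) ^ k := by
  rw [sum_range_dftCoef]
  refine tsum_of_norm_bounded summable_sqrt_half_pow.hasSum fun k =>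
    norm_blockForm_le k fun i => ?_
  split_ifs
  · exact hz i
  · simp

lemma tendsto_sum_range_dftCoef (x : InfTorus) :
    Tendsto (fun M => ∑ m ∈ Finset.range M, ∑ n ∈ Finset.range M,
      dftCoef m n * torusCoord x m * torusCoord x n) atTop (𝓝 (dftSeries x)) := by
  simp_rw [sum_range_dftCoef]
  refine tendsto_tsum_of_dominated_convergence summable_sqrt_half_pow (fun k => ?_)
    (.of_forall fun M k => norm_blockForm_le k fun i => ?_)
  · refine tendsto_const_nhds.congr' ?_
    filter_upwards [eventually_ge_atTop (2 ^ (k + 1))] with M hM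
    have hlt {m : ℕ} (hm : m ∈ dyadicBlock k) : m < M := by
      simp only [dyadicBlock, Finset.mem_Ico] at hm
      omega
    refine Finset.sum_congr rfl fun m hm => Finset.sum_congr rfl fun n hn => ?_
    simp only [hlt hm, hlt hn, if_true]
  · split_ifs
    · exact (norm_torusCoord x i).le
    · simp

/-- The factor by which `∂ / ∂x_p` multiplies the character `e ^ (2πi (x_m + x_n))`. -/
noncomputable def partialFactor (p m n : ℕ) : ℂ :=
  2 * Real.pi * Complex.I * ((if m = p then 1 else 0) + if n = p then 1 else 0)

/-- The factor by which an iterated partial derivative multiplies the character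
`e ^ (2πi (x_m + x_n))`. -/
noncomputable def iterPartialFactor (l : List ℕ) (m n : ℕ) : ℂ :=
  (l.map fun p => partialFactor p m n).prod

lemma hasDerivAt_torusCoord_update (x : InfTorus) (p m : ℕ) (t : ℝ) :
    HasDerivAt (fun s : ℝ => torusCoord (Function.update x p (s : AddCircle (1 : ℝ))) m)
      (2 * Real.pi * Complex.I * (if m = p then 1 else 0) *
        torusCoord (Function.update x p (t : AddCircle (1 : ℝ))) m) t := by
  by_cases h : m = p
  · subst h
    simpa [torusCoord, fourier_apply] using hasDerivAt_fourier (1 : ℝ) 1 t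
  · simpa [torusCoord, h] using hasDerivAt_const t ((x m).toCircle : ℂ)

lemma hasDerivAt_blockForm_update (l : List ℕ) (k : ℕ) (x : InfTorus) (p : ℕ) (t : ℝ) :
    HasDerivAt (fun s : ℝ => blockForm (iterPartialFactor l) k
        (torusCoord (Function.update x p (s : AddCircle (1 : ℝ)))))
      (blockForm (iterPartialFactor (p :: l)) k
        (torusCoord (Function.update x p (t : AddCircle (1 : ℝ))))) t := by
  unfold blockForm
  refine HasDerivAt.fun_sum fun m _ => HasDerivAt.fun_sum fun n _ => ?_
  refine (((hasDerivAt_torusCoord_update x p m t).const_mul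
    (iterPartialFactor l m n * dftCoef m n)).fun_mul
      (hasDerivAt_torusCoord_update x p n t)).congr_deriv ?_
  simp only [iterPartialFactor, List.map_cons, List.prod_cons, partialFactor]
  ring

lemma blockForm_iterPartialFactor_cons (p : ℕ) (l : List ℕ) {k : ℕ} (hk : k ≠ blockIndex p)
    (z : ℕ → ℂ) : blockForm (iterPartialFactor (p :: l)) k z = 0 := by
  refine Finset.sum_eq_zero fun m hm => Finset.sum_eq_zero fun n hn => ?_
  rw [mem_dyadicBlock] at hm hn
  have hmp : m ≠ p := by rintro rfl; exact hk hm.symm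
  have hnp : n ≠ p := by rintro rfl; exact hk hn.symm
  simp [iterPartialFactor, partialFactor, hmp, hnp]

lemma blockForm_update (c : ℕ → ℕ → ℂ) {p k : ℕ} (hk : k ≠ blockIndex p) (x : InfTorus)
    (y : AddCircle (1 : ℝ)) :
    blockForm c k (torusCoord (Function.update x p y)) = blockForm c k (torusCoord x) := by
  have hcoord {m : ℕ} (hm : m ∈ dyadicBlock k) :
      torusCoord (Function.update x p y) m = torusCoord x m := by
    have hmp : m ≠ p := by rintro rfl; exact hk (mem_dyadicBlock.1 hm).symm
    simp [torusCoord, hmp]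
  refine Finset.sum_congr rfl fun m hm => Finset.sum_congr rfl fun n hn => ?_
  rw [hcoord hm, hcoord hn]

lemma iterPartialFactor_nil : iterPartialFactor [] = 1 := by
  ext
  simp [iterPartialFactor]

lemma smoothInfTorus_dftSeries : SmoothInfTorus dftSeries := by
  have hcons (p : ℕ) (l : List ℕ) (x : InfTorus) :
      ∑' k, blockForm (iterPartialFactor (p :: l)) k (torusCoord x) =
        blockForm (iterPartialFactor (p :: l)) (blockIndex p) (torusCoord x) :=
    tsum_eq_single _ fun k hk => blockForm_iterPartialFactor_cons p l hk _
  have hsum (l : List ℕ) (x : InfTorus) :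
      Summable fun k => blockForm (iterPartialFactor l) k (torusCoord x) := by
    cases l with
    | nil => simpa only [iterPartialFactor_nil] using summable_blockForm x
    | cons p l =>
      exact (hasSum_single (blockIndex p) fun k hk =>
        blockForm_iterPartialFactor_cons p l hk _).summable
  refine ⟨fun l x => ∑' k, blockForm (iterPartialFactor l) k (torusCoord x), ?_, fun l => ?_,
    fun l p x t => ?_⟩
  · simp only [iterPartialFactor_nil]
    rfl
  · cases l with
    | nil =>
      simp only [iterPartialFactor_nil]
      exact continuous_dftSeries
    | cons p l =>
      simp only [hcons]
      exact continuous_blockForm_torusCoord _ _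
  · simp only [hcons]
    have hsplit (s : ℝ) :
        ∑' k, blockForm (iterPartialFactor l) k
          (torusCoord (Function.update x p (s : AddCircle (1 : ℝ)))) =
        blockForm (iterPartialFactor l) (blockIndex p)
          (torusCoord (Function.update x p (s : AddCircle (1 : ℝ)))) +
        ∑' k, if k = blockIndex p then 0 else blockForm (iterPartialFactor l) k (torusCoord x) := by
      rw [(hsum l _).tsum_eq_add_tsum_ite (blockIndex p)]
      congr 1
      refine tsum_congr fun k => ?_
      split_ifs with hk
      · rfl
      · exact blockForm_update _ hk x _
    simp only [hsplit]
    exact (hasDerivAt_blockForm_update l (blockIndex p) x p t).add_const _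

/-- The continuous homomorphism `x ↦ q · x` from the infinite torus to the circle. -/
def torusPairing (q : ℕ →₀ ℤ) (x : InfTorus) : AddCircle (1 : ℝ) := q.sum fun j c => c • x j

lemma torusPairing_add_left (q r : ℕ →₀ ℤ) (x : InfTorus) :
    torusPairing (q + r) x = torusPairing q x + torusPairing r x :=
  Finsupp.sum_add_index' (fun _ => zero_smul _ _) fun _ _ _ => add_smul _ _ _

lemma torusPairing_neg_left (q : ℕ →₀ ℤ) (x : InfTorus) :
    torusPairing (-q) x = -torusPairing q x := by
  rw [eq_neg_iff_add_eq_zero, ← torusPairing_add_left, neg_add_cancel]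
  simp [torusPairing]

lemma torusPairing_single (m : ℕ) (c : ℤ) (x : InfTorus) :
    torusPairing (Finsupp.single m c) x = c • x m :=
  Finsupp.sum_single_index (zero_smul _ _)

lemma torusPairing_add_right (q : ℕ →₀ ℤ) (x y : InfTorus) :
    torusPairing q (x + y) = torusPairing q x + torusPairing q y := by
  simp [torusPairing, Finsupp.sum, Finset.sum_add_distrib]

lemma continuous_torusPairing (q : ℕ →₀ ℤ) : Continuous (torusPairing q) := by
  unfold torusPairing Finsupp.sum
  fun_prop

/-- The characters of the infinite torus are orthonormal. -/
lemma integral_toCircle_torusPairing (ν : Measure InfTorus) [IsProbabilityMeasure ν]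
    [ν.IsAddHaarMeasure] (q : ℕ →₀ ℤ) :
    ∫ x, ((torusPairing q x).toCircle : ℂ) ∂ν = if q = 0 then 1 else 0 := by
  split_ifs with hq
  · simp [hq, torusPairing]
  obtain ⟨j, hj⟩ := Finsupp.ne_iff.1 hq
  rw [Finsupp.zero_apply] at hj
  let y : InfTorus := Pi.single j (((1 / (2 * q j) : ℝ)) : AddCircle (1 : ℝ))
  have hy : ((torusPairing q y).toCircle : ℂ) = -1 := by
    have h1 : torusPairing q y = ((1 / 2 : ℝ) : AddCircle (1 : ℝ)) := by
      rw [torusPairing, Finsupp.sum, Finset.sum_eq_single j]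
      · simp only [y, Pi.single_eq_same]
        rw [← AddCircle.coe_zsmul, zsmul_eq_mul]
        congr 1
        have : (q j : ℝ) ≠ 0 := by exact_mod_cast hj
        field_simp
      · intro i _ hi
        simp [y, hi]
      · intro h
        simp [Finsupp.notMem_support_iff.1 h]
    rw [h1, AddCircle.toCircle_apply_mk, Circle.coe_exp]
    convert Complex.exp_pi_mul_I using 3
    push_cast
    ring
  have h := integral_add_left_eq_self (μ := ν)
    (fun x : InfTorus => ((torusPairing q x).toCircle : ℂ)) y
  simp only [torusPairing_add_right, AddCircle.toCircle_add, Circle.coe_mul, hy,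
    integral_const_mul] at h
  linear_combination (-1 / 2) * h

/-- The Fourier coefficients of the limit are the limits of those of the square partial sums. -/
lemma tendsto_fourierCoefInf_dftSeries (ν : Measure InfTorus) [IsProbabilityMeasure ν]
    [ν.IsAddHaarMeasure] (p : ℕ →₀ ℤ) :
    Tendsto (fun M => ∑ m ∈ Finset.range M, ∑ n ∈ Finset.range M,
      if Finsupp.single m 1 + Finsupp.single n 1 = p then dftCoef m n else 0) atTop
      (𝓝 (fourierCoefInf ν dftSeries p)) := by
  have hc (q : ℕ →₀ ℤ) : Continuous fun x => ((torusPairing q x).toCircle : ℂ) :=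
    continuous_subtype_val.comp (AddCircle.continuous_toCircle.comp (continuous_torusPairing q))
  have hcoef (M : ℕ) : ∫ x, (∑ m ∈ Finset.range M, ∑ n ∈ Finset.range M,
      dftCoef m n * torusCoord x m * torusCoord x n) * ((torusPairing (-p) x).toCircle : ℂ) ∂ν =
      ∑ m ∈ Finset.range M, ∑ n ∈ Finset.range M,
        if Finsupp.single m 1 + Finsupp.single n 1 = p then dftCoef m n else 0 := by
    have hterm (m n : ℕ) (x : InfTorus) :
        dftCoef m n * torusCoord x m * torusCoord x n * ((torusPairing (-p) x).toCircle : ℂ) =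
        dftCoef m n *
          ((torusPairing (Finsupp.single m 1 + Finsupp.single n 1 + -p) x).toCircle : ℂ) := by
      simp only [torusPairing_add_left, torusPairing_single, one_smul, AddCircle.toCircle_add,
        Circle.coe_mul, torusCoord]
      ring
    have hint (m n : ℕ) : Integrable (fun x => dftCoef m n *
        ((torusPairing (Finsupp.single m 1 + Finsupp.single n 1 + -p) x).toCircle : ℂ)) ν :=
      (continuous_const.mul (hc _)).integrable_of_hasCompactSupport (.of_compactSpace _)
    simp_rw [Finset.sum_mul, hterm]
    rw [integral_finsetSum _ fun m _ => integrable_finsetSum _ fun n _ => hint m n]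
    refine Finset.sum_congr rfl fun m _ => ?_
    rw [integral_finsetSum _ fun n _ => hint m n]
    refine Finset.sum_congr rfl fun n _ => ?_
    rw [integral_const_mul, integral_toCircle_torusPairing]
    simp [add_neg_eq_zero]
  simp_rw [← hcoef]
  have hchar (x : InfTorus) : -(∑ j ∈ p.support, p j • x j) = torusPairing (-p) x := by
    rw [torusPairing_neg_left]; rfl
  simp only [fourierCoefInf, hchar]
  refine tendsto_integral_of_dominated_convergence (fun _ => ∑' k : ℕ, √(1 / 2 : ℝ) ^ k)
    (fun M => ?_) (integrable_const _) (fun M => .of_forall fun x => ?_)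
    (.of_forall fun x => (tendsto_sum_range_dftCoef x).mul_const _)
  · have := continuous_torusCoord
    have := hc (-p)
    exact Continuous.aestronglyMeasurable (by fun_prop)
  · rw [norm_mul, Circle.norm_coe, mul_one]
    exact norm_sum_range_dftCoef_le M fun i => (norm_torusCoord x i).le

lemma fourierCoefInf_dftSeries_eq (ν : Measure InfTorus) [IsProbabilityMeasure ν]
    [ν.IsAddHaarMeasure] {p : ℕ →₀ ℤ} {c : ℂ} (s : Finset (ℕ × ℕ))
    (hs : ∀ m n, Finsupp.single m 1 + Finsupp.single n 1 = p ↔ (m, n) ∈ s)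
    (hc : ∑ mn ∈ s, dftCoef mn.1 mn.2 = c) :
    fourierCoefInf ν dftSeries p = c := by
  refine tendsto_nhds_unique (tendsto_fourierCoefInf_dftSeries ν p) ?_
  refine tendsto_const_nhds.congr' ?_
  filter_upwards [eventually_ge_atTop (s.sup fun mn => max mn.1 mn.2 + 1)] with M hM
  rw [← Finset.sum_product', ← hc]
  simp only [hs]
  rw [Finset.sum_ite_mem, Finset.inter_eq_right.2]
  intro mn hmn
  have := (Finset.le_sup (f := fun mn : ℕ × ℕ => max mn.1 mn.2 + 1) hmn).trans hM
  simp only [Finset.mem_product, Finset.mem_range]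
  omega

lemma single_add_single_eq_iff (m n m' n' : ℕ) :
    (Finsupp.single m 1 + Finsupp.single n 1 : ℕ →₀ ℤ) =
      Finsupp.single m' 1 + Finsupp.single n' 1 ↔ m = m' ∧ n = n' ∨ m = n' ∧ n = m' := by
  rw [Finsupp.single_add_single_eq_single_add_single one_ne_zero one_ne_zero]
  simp

lemma fourierCoefInf_dftSeries_of_ne (ν : Measure InfTorus) [IsProbabilityMeasure ν]
    [ν.IsAddHaarMeasure] {m n : ℕ} (h : m ≠ n) :
    fourierCoefInf ν dftSeries (Finsupp.single m 1 + Finsupp.single n 1) = 2 * dftCoef m n := by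
  refine fourierCoefInf_dftSeries_eq ν {(m, n), (n, m)} (fun m' n' => ?_) ?_
  · rw [single_add_single_eq_iff]
    simp
  · rw [Finset.sum_pair (by simp [h]), dftCoef_comm n m, two_mul]

lemma fourierCoefInf_dftSeries_single (ν : Measure InfTorus) [IsProbabilityMeasure ν]
    [ν.IsAddHaarMeasure] (m : ℕ) :
    fourierCoefInf ν dftSeries (Finsupp.single m 2) = dftCoef m m := by
  refine fourierCoefInf_dftSeries_eq ν {(m, m)} (fun m' n' => ?_) (by simp)
  rw [show (2 : ℤ) = 1 + 1 by norm_num, Finsupp.single_add, single_add_single_eq_iff]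
  simp

lemma single_two (m : ℕ) :
    (Finsupp.single m 2 : ℕ →₀ ℤ) = Finsupp.single m 1 + Finsupp.single m 1 := by
  rw [← Finsupp.single_add]
  norm_num

lemma not_summable_fourierCoefInf_dftSeries (ν : Measure InfTorus) [IsProbabilityMeasure ν]
    [ν.IsAddHaarMeasure] : ¬ Summable fun p : ℕ →₀ ℤ => ‖fourierCoefInf ν dftSeries p‖ := by
  intro h
  let φ : ℕ × ℕ → ℕ →₀ ℤ := fun mn => Finsupp.single mn.1 1 + Finsupp.single mn.2 1
  let s : Set (ℕ × ℕ) := {mn | mn.1 ≤ mn.2}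
  let g : ℕ × ℕ → ℝ := s.indicator fun mn => ‖fourierCoefInf ν dftSeries (φ mn)‖
  have hφ : Function.Injective fun mn : s => φ mn := by
    rintro ⟨⟨m, n⟩, hmn⟩ ⟨⟨m', n'⟩, hmn'⟩ heq
    simp only [φ, single_add_single_eq_iff] at heq
    simp only [s, Set.mem_ofPred_eq] at hmn hmn'
    simp only [Subtype.mk.injEq, Prod.mk.injEq]
    omega
  have hg : Summable g := summable_subtype_iff_indicator.1 (h.comp_injective hφ)
  have hle (mn : ℕ × ℕ) : ‖dftCoef mn.1 mn.2‖ ≤ ‖fourierCoefInf ν dftSeries (φ mn)‖ := by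
    obtain ⟨m, n⟩ := mn
    by_cases hmn : m = n
    · subst hmn
      simp only [φ, ← single_two, fourierCoefInf_dftSeries_single, le_refl]
    · simp only [φ, fourierCoefInf_dftSeries_of_ne ν hmn, norm_mul, Complex.norm_ofNat]
      linarith [norm_nonneg (dftCoef m n)]
  refine not_summable_norm_dftCoef (.of_nonneg_of_le (fun _ => norm_nonneg _) (fun mn => ?_)
    (hg.add ((Equiv.prodComm ℕ ℕ).summable_iff.2 hg)))
  have hg0 (mn : ℕ × ℕ) : 0 ≤ g mn := Set.indicator_nonneg (fun _ _ => norm_nonneg _) _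
  rcases le_total mn.1 mn.2 with hmn | hmn
  · have : g mn = ‖fourierCoefInf ν dftSeries (φ mn)‖ := Set.indicator_of_mem (s := s) hmn _
    exact (this ▸ hle mn).trans (le_add_of_nonneg_right (hg0 _))
  · have : g mn.swap = ‖fourierCoefInf ν dftSeries (φ mn.swap)‖ :=
      Set.indicator_of_mem (s := s) hmn _
    rw [dftCoef_comm]
    exact (this ▸ hle mn.swap).trans (le_add_of_nonneg_left (hg0 _))

/-- There is a function `F ∈ C^∞(𝕋^ω)` whose Fourier series diverges
absolutely. Concretely, `F(x) = ∑_{m,n} a_{mn} e^{2πi(x_m+x_n)}` where `(a_{mn})` is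
symmetric, completely bounded on the unit polydisc, and `∑ |a_{mn}| = ∞`; with respect to
the (normalized Haar) probability measure of `𝕋^ω`, its Fourier coefficients are
`F̂(ē_m + ē_n) = 2 a_{mn}` for `m ≠ n`, `F̂(2ē_m) = a_{mm}`, and `F̂(p̄) = 0` otherwise, so
that `∑_{p̄ ∈ ℤ^∞} |F̂(p̄)| = ∞`. -/
theorem statement19 :
    ∃ (a : ℕ → ℕ → ℂ) (F : InfTorus → ℂ),
      (∀ m n, a m n = a n m) ∧
      (∃ H : ℝ, ∀ (M : ℕ) (z : ℕ → ℂ), (∀ i, ‖z i‖ ≤ 1) →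
        ‖∑ m ∈ Finset.range M, ∑ n ∈ Finset.range M, a m n * z m * z n‖ ≤ H) ∧
      ¬ Summable (fun mn : ℕ × ℕ => ‖a mn.1 mn.2‖) ∧
      (∀ x : InfTorus,
        Tendsto (fun M => ∑ m ∈ Finset.range M, ∑ n ∈ Finset.range M,
            a m n * ((AddCircle.toCircle (x m + x n) : Circle) : ℂ)) atTop (𝓝 (F x))) ∧
      SmoothInfTorus F ∧
      ∀ ν : Measure InfTorus, IsProbabilityMeasure ν → ν.IsAddHaarMeasure →
        (∀ m n, m ≠ n →
          fourierCoefInf ν F (Finsupp.single m 1 + Finsupp.single n 1) = 2 * a m n) ∧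
        (∀ m, fourierCoefInf ν F (Finsupp.single m 2) = a m m) ∧
        (∀ p : ℕ →₀ ℤ, (¬ ∃ m n, m ≠ n ∧ p = Finsupp.single m 1 + Finsupp.single n 1) →
          (¬ ∃ m, p = Finsupp.single m 2) → fourierCoefInf ν F p = 0) ∧
        ¬ Summable (fun p : ℕ →₀ ℤ => ‖fourierCoefInf ν F p‖) := by
  refine ⟨dftCoef, dftSeries, dftCoef_comm, ⟨_, fun M z hz => norm_sum_range_dftCoef_le M hz⟩,
    not_summable_norm_dftCoef, fun x => ?_, smoothInfTorus_dftSeries, fun ν _ _ =>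
    ⟨fun m n h => fourierCoefInf_dftSeries_of_ne ν h, fourierCoefInf_dftSeries_single ν,
      fun p hp hp' => ?_, not_summable_fourierCoefInf_dftSeries ν⟩⟩
  · simpa only [AddCircle.toCircle_add, Circle.coe_mul, ← mul_assoc, torusCoord]
      using tendsto_sum_range_dftCoef x
  · refine fourierCoefInf_dftSeries_eq ν ∅ (fun m n => ?_) Finset.sum_empty
    simp only [Finset.notMem_empty, iff_false]
    rintro rfl
    by_cases h : m = n
    · exact hp' ⟨m, by rw [single_two, h]⟩
    · exact hp ⟨m, n, h, rfl⟩
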